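/- For every ε > 0 and every positive integer m there is a positive integer M (with M ≥ m) such that every graph G with at least M vertices and at least one edge has an (ε)-regular partition 𝒫 = V₀∪V₁∪…∪V_k with exceptional set V₀ and m ≤ k ≤ M. -/

import Mathlib

open Finset

open Classical in
/-- `e(X,Y)`: the number of edges of `G` with one end in `X` and the other in `Y`
(for disjoint `X`, `Y`). -/
noncomputable def edgesBetween {n : ℕ} (G : SimpleGraph (Fin n)) (X Y : Finset (Fin n)) : ℕ :=
  ((X ×ˢ Y).filter fun xy => G.Adj xy.1 xy.2).card

/-- `d(X,Y)`: the density of the pair `(X,Y)`. -/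
noncomputable def gdens {n : ℕ} (G : SimpleGraph (Fin n)) (X Y : Finset (Fin n)) : ℝ :=
  (edgesBetween G X Y : ℝ) / ((X.card : ℝ) * (Y.card : ℝ))

open Classical in
/-- `e(G)`: the number of edges of `G`. -/
noncomputable def edgeCount {n : ℕ} (G : SimpleGraph (Fin n)) : ℕ :=
  ((Finset.univ : Finset (Sym2 (Fin n))).filter fun e => e ∈ G.edgeSet).card

/-- `d(G) = e(G)/binom(|G|,2)`: the density of `G`. -/
noncomputable def graphDensity {n : ℕ} (G : SimpleGraph (Fin n)) : ℝ :=
  (edgeCount G : ℝ) / (n.choose 2 : ℝ)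

/-- The pair `(X,Y)` is `(ε,p)`-regular in `G`. -/
def PairRegular {n : ℕ} (G : SimpleGraph (Fin n)) (ε p : ℝ) (X Y : Finset (Fin n)) : Prop :=
  ∀ X' ⊆ X, ∀ Y' ⊆ Y, ε * X.card ≤ X'.card → ε * Y.card ≤ Y'.card →
    |gdens G X' Y' - gdens G X Y| < ε * p

/-- A partition of the vertex set with an exceptional set and `k` non-exceptional classes
is encoded as a map `p : Fin n → Fin (k+1)`; class `0` is the exceptional set, and
`classOf p i` is the `i`-th class. -/
def classOf {n k : ℕ} (p : Fin n → Fin (k + 1)) (i : Fin (k + 1)) : Finset (Fin n) :=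
  Finset.univ.filter fun x => p x = i

/-- The partition encoded by `p` (with exceptional class `0`) is balanced: all
non-exceptional classes have equal size. -/
def BalancedP {n k : ℕ} (p : Fin n → Fin (k + 1)) : Prop :=
  ∀ i j : Fin (k + 1), i ≠ 0 → j ≠ 0 → (classOf p i).card = (classOf p j).card

open Classical in
/-- `p` encodes an `(ε)`-regular partition of `G` with exceptional set the class `0`:
it is balanced, the exceptional set has size `< ε·n`, and all but at most `ε·k²` of the
pairs `(Vᵢ,Vⱼ)` with `i > j ≥ 1` are `(ε,d)`-regular, where `d` is the density of `G`. -/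
def ScaledEpsRegularGraphPartition {n k : ℕ} (G : SimpleGraph (Fin n)) (ε : ℝ)
    (p : Fin n → Fin (k + 1)) : Prop :=
  BalancedP p ∧ ((classOf p 0).card : ℝ) < ε * n ∧
  ((((Finset.univ : Finset (Fin (k + 1) × Fin (k + 1))).filter fun ij =>
      ij.2 ≠ 0 ∧ ij.2 < ij.1 ∧
      ¬ PairRegular G ε (graphDensity G) (classOf p ij.1) (classOf p ij.2)).card : ℝ)
    ≤ ε * (k : ℝ) ^ 2)

section CellAverage

variable {Ω ι κ : Type*} [Fintype Ω]

open Classical in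
/-- The average of `a` over the fibre of `F` containing `x`. -/
noncomputable def cellAvg (a : Ω → ℝ) (F : Ω → ι) (x : Ω) : ℝ :=
  (∑ y with F y = F x, a y) / (#{y | F y = F x} : ℝ)

/-- A bounded convex potential: the sum of `1 / (1 + t)` over the cell averages `t` of `a`. -/
noncomputable def potential (a : Ω → ℝ) (F : Ω → ι) : ℝ :=
  ∑ x, 1 / (1 + cellAvg a F x)

lemma cellAvg_nonneg {a : Ω → ℝ} (ha : ∀ x, 0 ≤ a x) (F : Ω → ι) (x : Ω) :
    0 ≤ cellAvg a F x :=
  div_nonneg (Finset.sum_nonneg fun y _ => ha y) (Nat.cast_nonneg _)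

lemma cellAvg_congr (a : Ω → ℝ) {F : Ω → ι} {x y : Ω} (h : F x = F y) :
    cellAvg a F x = cellAvg a F y := by
  rw [cellAvg, cellAvg, h]

lemma potential_nonneg {a : Ω → ℝ} (ha : ∀ x, 0 ≤ a x) (F : Ω → ι) : 0 ≤ potential a F :=
  Finset.sum_nonneg fun x _ => by
    have := cellAvg_nonneg ha F x
    positivity

lemma potential_le_card {a : Ω → ℝ} (ha : ∀ x, 0 ≤ a x) (F : Ω → ι) :
    potential a F ≤ Fintype.card Ω := by
  have h : ∀ x ∈ (univ : Finset Ω), 1 / (1 + cellAvg a F x) ≤ (1 : ℝ) := fun x _ => by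
    have := cellAvg_nonneg ha F x
    rw [div_le_one (by linarith)]
    linarith
  simpa [potential] using Finset.sum_le_sum h

lemma sum_mul_cellAvg (a c : Ω → ℝ) {F : Ω → ι} (hc : ∀ x y, F x = F y → c x = c y) :
    ∑ x, c x * cellAvg a F x = ∑ x, c x * a x := by
  classical
  have h1 : ∀ x, c x * cellAvg a F x =
      ∑ y, if F y = F x then c y * a y / (#{z | F z = F y} : ℝ) else 0 := by
    intro x
    rw [cellAvg, mul_div_assoc', Finset.mul_sum, Finset.sum_div, ← Finset.sum_filter]
    refine Finset.sum_congr (by congr) fun y hy => ?_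
    have hy' : F y = F x := by simpa using hy
    rw [hc y x hy', hy']
  simp_rw [h1]
  rw [Finset.sum_comm]
  refine Finset.sum_congr rfl fun y _ => ?_
  have h2 : ∀ x, (F y = F x) = (F x = F y) := fun x => propext eq_comm
  simp_rw [h2]
  rw [← Finset.sum_filter, Finset.sum_const, nsmul_eq_mul]
  have hpos : (0 : ℝ) < #{z | F z = F y} := by
    exact_mod_cast Finset.card_pos.mpr ⟨y, by simp⟩
  field_simp

lemma sum_cellAvg_of_saturated (a : Ω → ℝ) {F : Ω → ι} {S : Finset Ω}
    (hS : ∀ x y, F x = F y → (x ∈ S ↔ y ∈ S)) :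
    ∑ x ∈ S, cellAvg a F x = ∑ x ∈ S, a x := by
  classical
  have := sum_mul_cellAvg a (fun x => if x ∈ S then 1 else 0) (F := F)
    fun x y h => by simp only [hS x y h]
  simpa [Finset.sum_ite_mem] using this

lemma potential_sub_potential {a : Ω → ℝ} (ha : ∀ x, 0 ≤ a x) {Q : Ω → ι} {R : Ω → κ}
    (h : ∀ x y, R x = R y → Q x = Q y) :
    potential a R - potential a Q = ∑ x, (cellAvg a R x - cellAvg a Q x) ^ 2 /
      ((1 + cellAvg a R x) * (1 + cellAvg a Q x) ^ 2) := by
  set c : Ω → ℝ := fun x => 1 / (1 + cellAvg a Q x) ^ 2 with hcdef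
  have hc : ∀ x y, Q x = Q y → c x = c y := fun x y hxy => by
    simp only [hcdef, cellAvg_congr a hxy]
  have h0 : ∑ x, c x * cellAvg a Q x - ∑ x, c x * cellAvg a R x = 0 := by
    rw [sum_mul_cellAvg a c hc, sum_mul_cellAvg a c fun x y hxy => hc x y (h x y hxy), sub_self]
  rw [← sub_eq_zero, ← h0, potential, potential, ← Finset.sum_sub_distrib,
    ← Finset.sum_sub_distrib, ← Finset.sum_sub_distrib, ← sub_eq_zero,
    ← Finset.sum_sub_distrib]
  refine Finset.sum_eq_zero fun x _ => ?_
  have hs := cellAvg_nonneg ha R x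
  have ht := cellAvg_nonneg ha Q x
  simp only [hcdef]
  field_simp
  ring

lemma potential_mono {a : Ω → ℝ} (ha : ∀ x, 0 ≤ a x) {Q : Ω → ι} {R : Ω → κ}
    (h : ∀ x y, R x = R y → Q x = Q y) : potential a Q ≤ potential a R := by
  rw [← sub_nonneg, potential_sub_potential ha h]
  refine Finset.sum_nonneg fun x _ => ?_
  have := cellAvg_nonneg ha R x
  positivity

lemma sq_div_lower_bound {ε C t σ : ℝ} (hε : 0 < ε) (ht : 0 ≤ t) (htC : t ≤ C) (hσ : 0 ≤ σ)
    (h : ε ≤ |σ - t|) :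
    ε ^ 2 / (1 + C + ε) ^ 3 ≤ (σ - t) ^ 2 / ((1 + σ) * (1 + t) ^ 2) := by
  have hC : 0 ≤ C := ht.trans htC
  have h1 : ε ^ 2 / (1 + C + ε) ≤ (σ - t) ^ 2 / (1 + σ) := by
    rw [div_le_div_iff₀ (by positivity) (by positivity)]
    have hsq : ε ^ 2 ≤ (σ - t) ^ 2 := by
      rw [← sq_abs (σ - t)]
      exact pow_le_pow_left₀ hε.le h 2
    rcases le_or_gt t σ with hts | hts
    · rw [abs_of_nonneg (by linarith)] at h
      have h2 : ε ^ 2 * (σ - t) ≤ (σ - t) ^ 2 * ε := by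
        nlinarith [mul_nonneg (mul_nonneg hε.le (hε.le.trans h)) (sub_nonneg.mpr h)]
      nlinarith [mul_le_mul hsq (show 1 + t ≤ 1 + C by linarith) (by linarith) (sq_nonneg _)]
    · exact mul_le_mul hsq (by linarith) (by linarith) (sq_nonneg _)
  calc ε ^ 2 / (1 + C + ε) ^ 3 = ε ^ 2 / (1 + C + ε) / (1 + C + ε) ^ 2 := by
        field_simp
    _ ≤ (σ - t) ^ 2 / (1 + σ) / (1 + t) ^ 2 := by
        exact div_le_div₀ (by positivity) h1 (by positivity)
          (pow_le_pow_left₀ (by linarith) (by linarith) 2)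
    _ = _ := by rw [div_div]

/-- The contribution to the potential increment of a set `S` on which the coarse average is
a constant `t` far from the mean of `a` over `S`. -/
lemma increment_on_set {a : Ω → ℝ} (ha : ∀ x, 0 ≤ a x) {Q : Ω → ι} {R : Ω → κ}
    {S : Finset Ω} (hSne : S.Nonempty) (hS : ∀ x y, R x = R y → (x ∈ S ↔ y ∈ S))
    {ε C t : ℝ} (hε : 0 < ε) (ht : 0 ≤ t) (htC : t ≤ C) (hQ : ∀ x ∈ S, cellAvg a Q x = t)
    (hdev : ε ≤ |(∑ x ∈ S, a x) / (#S : ℝ) - t|) :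
    #S * (ε ^ 2 / (1 + C + ε) ^ 3) ≤ ∑ x ∈ S, (cellAvg a R x - cellAvg a Q x) ^ 2 /
      ((1 + cellAvg a R x) * (1 + cellAvg a Q x) ^ 2) := by
  have hpos : (0 : ℝ) < #S := by exact_mod_cast hSne.card_pos
  set σ : ℝ := (∑ x ∈ S, a x) / (#S : ℝ) with hσdef
  have hσ : 0 ≤ σ := div_nonneg (Finset.sum_nonneg fun y _ => ha y) hpos.le
  have hsum : ∑ x ∈ S, cellAvg a R x = #S * σ := by
    rw [sum_cellAvg_of_saturated a hS, hσdef]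
    field_simp
  set l : ℝ := (σ - t) / (1 + σ) with hl
  have hterm : ∀ x ∈ S, (2 * l * (cellAvg a R x - t) - l ^ 2 * (1 + cellAvg a R x)) /
      (1 + t) ^ 2 ≤ (cellAvg a R x - cellAvg a Q x) ^ 2 /
      ((1 + cellAvg a R x) * (1 + cellAvg a Q x) ^ 2) := by
    intro x hx
    have hs := cellAvg_nonneg ha R x
    rw [hQ x hx, ← div_div]
    gcongr
    rw [le_div_iff₀ (by positivity)]
    nlinarith [sq_nonneg (cellAvg a R x - t - l * (1 + cellAvg a R x))]
  refine le_trans ?_ (Finset.sum_le_sum hterm)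
  rw [← Finset.sum_div, Finset.sum_sub_distrib, ← Finset.mul_sum, ← Finset.mul_sum,
    Finset.sum_sub_distrib, Finset.sum_add_distrib, hsum, Finset.sum_const, Finset.sum_const,
    nsmul_eq_mul, nsmul_eq_mul]
  have heq : (2 * l * (#S * σ - #S * t) - l ^ 2 * (#S * 1 + #S * σ)) / (1 + t) ^ 2 =
      #S * ((σ - t) ^ 2 / ((1 + σ) * (1 + t) ^ 2)) := by
    rw [hl]
    field_simp
    ring
  rw [heq]
  exact mul_le_mul_of_nonneg_left (sq_div_lower_bound hε ht htC hσ hdev) hpos.le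

end CellAverage

section Pieces

/-- Any partition of the vertices can be cut into monochromatic classes of size exactly `s`,
leaving fewer than `s` vertices of each colour in the exceptional class. -/
lemma exists_monochromatic_pieces {n K s : ℕ} (hs : 0 < s) (P : Fin n → Fin K) :
    ∃ (k : ℕ) (p : Fin n → Fin (k + 1)), (∀ i, i ≠ 0 → (classOf p i).card = s) ∧
      (∀ x y, p x ≠ 0 → p x = p y → P x = P y) ∧ (classOf p 0).card ≤ K * s := by
  classical
  let good : Finset (Finset (Finset (Fin n))) := univ.filter fun 𝒜 =>
    (∀ A ∈ 𝒜, #A = s ∧ ∀ x ∈ A, ∀ y ∈ A, P x = P y) ∧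
      ∀ A ∈ 𝒜, ∀ B ∈ 𝒜, ∀ x, x ∈ A → x ∈ B → A = B
  obtain ⟨𝒜, h𝒜, hmax⟩ := good.exists_max_image Finset.card ⟨∅, by simp [good]⟩
  simp only [good, Finset.mem_filter, Finset.mem_univ, true_and] at h𝒜 hmax
  obtain ⟨hA, hdisj⟩ := h𝒜
  have hchoose : ∀ x : Fin n, ∃ q : Fin (#𝒜 + 1),
      (∀ A (h : A ∈ 𝒜), x ∈ A → q = (𝒜.equivFin ⟨A, h⟩).succ) ∧
      (q ≠ 0 → ∃ A ∈ 𝒜, x ∈ A) := by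
    intro x
    by_cases h : ∃ A ∈ 𝒜, x ∈ A
    · obtain ⟨A, hA', hx⟩ := h
      refine ⟨(𝒜.equivFin ⟨A, hA'⟩).succ, fun B hB hxB => ?_, fun _ => ⟨A, hA', hx⟩⟩
      have := hdisj A hA' B hB x hx hxB
      subst this
      rfl
    · exact ⟨0, fun A hA' hx => (h ⟨A, hA', hx⟩).elim, fun h0 => (h0 rfl).elim⟩
  choose p hp hp0 using hchoose
  have hclass : ∀ A (h : A ∈ 𝒜), classOf p (𝒜.equivFin ⟨A, h⟩).succ = A := by
    intro A h
    ext x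
    simp only [classOf, Finset.mem_filter, Finset.mem_univ, true_and]
    refine ⟨fun hx => ?_, fun hx => hp x A h hx⟩
    obtain ⟨B, hB, hxB⟩ := hp0 x (by rw [hx]; exact Fin.succ_ne_zero _)
    have h1 := hp x B hB hxB
    rw [hx, Fin.succ_inj, Equiv.apply_eq_iff_eq, Subtype.mk.injEq] at h1
    rwa [h1]
  refine ⟨#𝒜, p, fun i hi => ?_, fun x y hx hxy => ?_, ?_⟩
  · obtain ⟨j, rfl⟩ := Fin.exists_succ_eq.mpr hi
    obtain ⟨⟨A, h⟩, rfl⟩ := 𝒜.equivFin.surjective j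
    rw [hclass A h]
    exact (hA A h).1
  · obtain ⟨A, h, hxA⟩ := hp0 x hx
    have hyA : y ∈ A := by
      rw [← hclass A h]
      simp only [classOf, Finset.mem_filter, Finset.mem_univ, true_and]
      rw [← hxy]
      exact hp x A h hxA
    exact (hA A h).2 x hxA y hyA
  · have hcell : ∀ c ∈ (univ : Finset (Fin K)), #{x ∈ classOf p 0 | P x = c} ≤ s := by
      intro c _
      by_contra! hlt
      obtain ⟨B, hB, hBs⟩ := Finset.exists_subset_card_eq hlt.le
      have hB0 : ∀ x ∈ B, p x = 0 ∧ P x = c := fun x hx => by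
        simpa [classOf] using hB hx
      have hBdisj : ∀ A ∈ 𝒜, ∀ x ∈ A, x ∉ B := fun A h x hx hxB =>
        Fin.succ_ne_zero _ ((hp x A h hx).symm.trans (hB0 x hxB).1)
      have hBne : B.Nonempty := Finset.card_pos.mp (hBs ▸ hs)
      have hBn : B ∉ 𝒜 := fun h => hBne.elim fun x hx => hBdisj B h x hx hx
      have := hmax (insert B 𝒜) ⟨?_, ?_⟩
      · rw [Finset.card_insert_of_notMem hBn] at this
        omega
      · intro A h
        rcases Finset.mem_insert.mp h with rfl | h
        · exact ⟨hBs, fun x hx y hy => (hB0 x hx).2.trans (hB0 y hy).2.symm⟩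
        · exact hA A h
      · intro A h A' h' x hx hx'
        rcases Finset.mem_insert.mp h with hAB | hA𝒜 <;>
          rcases Finset.mem_insert.mp h' with hAB' | hA𝒜'
        · exact hAB.trans hAB'.symm
        · exact (hBdisj A' hA𝒜' x hx' (hAB ▸ hx)).elim
        · exact (hBdisj A hA𝒜 x hx (hAB' ▸ hx')).elim
        · exact hdisj A hA𝒜 A' hA𝒜' x hx hx'
    calc (classOf p 0).card = ∑ c, #{x ∈ classOf p 0 | P x = c} :=
          Finset.card_eq_sum_card_fiberwise fun x _ => Finset.mem_coe.mpr (Finset.mem_univ _)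
      _ ≤ ∑ _c : Fin K, s := Finset.sum_le_sum hcell
      _ = K * s := by simp

end Pieces

section Graph

variable {n : ℕ}

open Classical in
/-- The adjacency indicator of `G`, normalised by the density of `G`. -/
noncomputable def normAdj (G : SimpleGraph (Fin n)) (x : Fin n × Fin n) : ℝ :=
  (if G.Adj x.1 x.2 then 1 else 0) / graphDensity G

lemma graphDensity_nonneg (G : SimpleGraph (Fin n)) : 0 ≤ graphDensity G :=
  div_nonneg (Nat.cast_nonneg _) (Nat.cast_nonneg _)

lemma normAdj_nonneg (G : SimpleGraph (Fin n)) (x : Fin n × Fin n) : 0 ≤ normAdj G x :=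
  div_nonneg (by split_ifs <;> norm_num) (graphDensity_nonneg G)

lemma sum_product_normAdj (G : SimpleGraph (Fin n)) (X Y : Finset (Fin n)) :
    ∑ x ∈ X ×ˢ Y, normAdj G x = edgesBetween G X Y / graphDensity G := by
  classical
  simp only [normAdj, edgesBetween]
  rw [← Finset.sum_div, Finset.sum_boole]

lemma avg_normAdj (G : SimpleGraph (Fin n)) (X Y : Finset (Fin n)) :
    (∑ x ∈ X ×ˢ Y, normAdj G x) / (#(X ×ˢ Y) : ℝ) = gdens G X Y / graphDensity G := by
  rw [sum_product_normAdj, gdens, Finset.card_product, Nat.cast_mul, div_right_comm]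

lemma edgesBetween_univ (G : SimpleGraph (Fin n)) :
    edgesBetween G univ univ = 2 * edgeCount G := by
  classical
  have h : edgeCount G = #G.edgeFinset := by
    unfold edgeCount
    congr 1
    ext e
    simp
  rw [h, ← G.sum_degrees_eq_twice_card_edges, edgesBetween, Finset.card_filter,
    Finset.sum_product]
  refine Finset.sum_congr rfl fun x _ => ?_
  rw [← Finset.card_filter, ← G.card_neighborFinset_eq_degree]
  congr 1
  ext y
  simp

lemma edgeCount_pos {G : SimpleGraph (Fin n)} (h : ∃ x y, G.Adj x y) : 0 < edgeCount G := by
  classical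
  obtain ⟨x, y, hxy⟩ := h
  exact Finset.card_pos.mpr ⟨s(x, y), by simpa using hxy⟩

lemma two_le_of_adj {G : SimpleGraph (Fin n)} (h : ∃ x y, G.Adj x y) : 2 ≤ n := by
  obtain ⟨x, y, hxy⟩ := h
  have := hxy.ne
  have hx := x.2
  have hy := y.2
  by_contra! hn
  exact this (Fin.ext (by omega))

lemma graphDensity_pos {G : SimpleGraph (Fin n)} (h : ∃ x y, G.Adj x y) :
    0 < graphDensity G :=
  div_pos (by exact_mod_cast edgeCount_pos h)
    (by exact_mod_cast Nat.choose_pos (two_le_of_adj h))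

lemma sum_normAdj_le {G : SimpleGraph (Fin n)} (h : ∃ x y, G.Adj x y) :
    ∑ x, normAdj G x ≤ (n : ℝ) ^ 2 := by
  have h1 := sum_product_normAdj G univ univ
  have he : (0 : ℝ) < edgeCount G := by exact_mod_cast edgeCount_pos h
  have h2 := Nat.choose_pos (two_le_of_adj h)
  have hc : (0 : ℝ) < n.choose 2 := by exact_mod_cast h2
  rw [Finset.univ_product_univ, edgesBetween_univ, graphDensity] at h1
  rw [h1]
  push_cast
  have : 2 * (edgeCount G : ℝ) / (edgeCount G / (n.choose 2 : ℝ)) = 2 * n.choose 2 := by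
    field_simp
  rw [this, Nat.cast_choose_two]
  nlinarith [(Nat.cast_nonneg n : (0 : ℝ) ≤ n)]

lemma cellAvg_normAdj {ι : Type*} (G : SimpleGraph (Fin n)) {f : Fin n → ι}
    {X Y : Finset (Fin n)} {x y : Fin n} (hX : ∀ z, f z = f x ↔ z ∈ X)
    (hY : ∀ z, f z = f y ↔ z ∈ Y) :
    cellAvg (normAdj G) (Prod.map f f) (x, y) = gdens G X Y / graphDensity G := by
  classical
  rw [← avg_normAdj, cellAvg]
  have : (univ.filter fun z => Prod.map f f z = Prod.map f f (x, y)) = X ×ˢ Y := by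
    ext ⟨u, v⟩
    simp [hX, hY]
  rw [← this]
  congr!

/-- Few pairs of classes have large normalised density. -/
lemma card_dense_pairs_le {G : SimpleGraph (Fin n)} (h : ∃ x y, G.Adj x y) {k s : ℕ}
    (p : Fin n → Fin (k + 1)) (hp : ∀ i, i ≠ 0 → (classOf p i).card = s)
    {C : ℝ} (D : Finset (Fin (k + 1) × Fin (k + 1)))
    (hD : ∀ ij ∈ D, ij.1 ≠ 0 ∧ ij.2 ≠ 0 ∧
      C ≤ gdens G (classOf p ij.1) (classOf p ij.2) / graphDensity G) :
    #D * ((s : ℝ) ^ 2 * C) ≤ (n : ℝ) ^ 2 := by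
  classical
  refine le_trans ?_ (sum_normAdj_le h)
  have hfib : ∑ ij ∈ D, ∑ x with Prod.map p p x = ij, normAdj G x ≤ ∑ x, normAdj G x := by
    rw [← Finset.sum_fiberwise univ (Prod.map p p) (normAdj G)]
    exact Finset.sum_le_sum_of_subset_of_nonneg (Finset.subset_univ _)
      fun ij _ _ => Finset.sum_nonneg fun x _ => normAdj_nonneg G x
  refine le_trans ?_ hfib
  rw [← nsmul_eq_mul]
  refine Finset.card_nsmul_le_sum _ _ _ fun ij hij => ?_
  obtain ⟨hi, hj, hC⟩ := hD ij hij
  have hset : (univ.filter fun x => Prod.map p p x = ij) =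
      classOf p ij.1 ×ˢ classOf p ij.2 := by
    ext ⟨u, v⟩
    simp [classOf, Prod.ext_iff]
  rw [hset]
  have havg := avg_normAdj G (classOf p ij.1) (classOf p ij.2)
  rw [← havg, Finset.card_product, hp _ hi, hp _ hj] at hC
  rcases Nat.eq_zero_or_pos s with rfl | hs
  · simpa using Finset.sum_nonneg fun x _ => normAdj_nonneg G x
  · have hs' : (0 : ℝ) < s := by exact_mod_cast hs
    push_cast at hC
    rw [le_div_iff₀ (by positivity)] at hC
    linarith

/-- A partition into classes of size `s` that fails to be regular on many pairs can be refined
so that the potential increases by a fixed proportion. -/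
lemma exists_refinement {G : SimpleGraph (Fin n)} (hG : ∃ x y, G.Adj x y) {ε : ℝ} (hε : 0 < ε)
    {K k s : ℕ} (hs : 0 < s) (P : Fin n → Fin K) (p : Fin n → Fin (k + 1))
    (hp : ∀ i, i ≠ 0 → (classOf p i).card = s)
    (hmono : ∀ x y, p x ≠ 0 → p x = p y → P x = P y) (hn : (n : ℝ) ≤ 2 * (k * s))
    (B : Finset (Fin (k + 1) × Fin (k + 1)))
    (hB : ∀ ij ∈ B, ij.1 ≠ 0 ∧ ij.2 ≠ 0 ∧
      ¬ PairRegular G ε (graphDensity G) (classOf p ij.1) (classOf p ij.2))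
    (hBcard : ε * (k : ℝ) ^ 2 ≤ #B) :
    ∃ R : Fin n → (Fin (k + 1) × Fin K) × (Fin (k + 1) × Fin (k + 1) → Prop × Prop),
      potential (normAdj G) (Prod.map P P) +
          ε ^ 5 / (8 * (1 + 8 / ε + ε) ^ 3) * (n : ℝ) ^ 2 ≤
        potential (normAdj G) (Prod.map R R) := by
  classical
  have hd := graphDensity_pos hG
  have hs' : (0 : ℝ) < s := by exact_mod_cast hs
  have hwit : ∀ ij : Fin (k + 1) × Fin (k + 1), ∃ X Y : Finset (Fin n), ij ∈ B →
      X ⊆ classOf p ij.1 ∧ Y ⊆ classOf p ij.2 ∧ ε * s ≤ #X ∧ ε * s ≤ #Y ∧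
      ε * graphDensity G ≤
        |gdens G X Y - gdens G (classOf p ij.1) (classOf p ij.2)| := by
    intro ij
    by_cases hij : ij ∈ B
    · obtain ⟨hi, hj, hreg⟩ := hB ij hij
      simp only [PairRegular, hp _ hi, hp _ hj] at hreg
      push Not at hreg
      obtain ⟨X, hX, Y, hY, h1, h2, h3⟩ := hreg
      exact ⟨X, Y, fun _ => ⟨hX, hY, h1, h2, h3⟩⟩
    · exact ⟨∅, ∅, fun h => (hij h).elim⟩
  choose X Y hXY using hwit
  let Q : Fin n → Fin (k + 1) × Fin K := fun x => (p x, P x)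
  let R : Fin n → (Fin (k + 1) × Fin K) × (Fin (k + 1) × Fin (k + 1) → Prop × Prop) :=
    fun x => (Q x, fun ij => (x ∈ X ij, x ∈ Y ij))
  refine ⟨R, ?_⟩
  have ha := normAdj_nonneg G
  have hPQ : potential (normAdj G) (Prod.map P P) ≤ potential (normAdj G) (Prod.map Q Q) :=
    potential_mono ha fun x y h => by
      simp only [Prod.map, Q, Prod.mk.injEq] at h ⊢
      exact ⟨h.1.2, h.2.2⟩
  have hRQ : ∀ x y, Prod.map R R x = Prod.map R R y → Prod.map Q Q x = Prod.map Q Q y := by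
    intro x y h
    simp only [Prod.map, R, Prod.mk.injEq] at h ⊢
    exact ⟨h.1.1, h.2.1⟩
  have hinc := potential_sub_potential ha hRQ
  set inc : Fin n × Fin n → ℝ := fun x =>
    (cellAvg (normAdj G) (Prod.map R R) x - cellAvg (normAdj G) (Prod.map Q Q) x) ^ 2 /
      ((1 + cellAvg (normAdj G) (Prod.map R R) x) *
        (1 + cellAvg (normAdj G) (Prod.map Q Q) x) ^ 2) with hincdef
  have hinc0 : ∀ x, 0 ≤ inc x := fun x => by
    have := cellAvg_nonneg ha (Prod.map R R) x
    simp only [hincdef]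
    positivity
  set t : Fin (k + 1) × Fin (k + 1) → ℝ := fun ij =>
    gdens G (classOf p ij.1) (classOf p ij.2) / graphDensity G with htdef
  set C : ℝ := 8 / ε with hC
  have hCpos : 0 < C := by positivity
  set g : ℝ := ε ^ 2 / (1 + C + ε) ^ 3 with hg
  have hgpos : 0 < g := by positivity
  have hpair : ∀ ij ∈ B.filter (fun ij => t ij ≤ C),
      (ε * s) ^ 2 * g ≤ ∑ x with Prod.map p p x = ij, inc x := by
    intro ij hij
    obtain ⟨hijB, hijC⟩ := Finset.mem_filter.mp hij
    obtain ⟨hi, hj, -⟩ := hB ij hijB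
    obtain ⟨hX, hY, hXc, hYc, hdev⟩ := hXY ij hijB
    have hcell : ∀ z, p z ≠ 0 → ∀ w, Q w = Q z ↔ w ∈ classOf p (p z) := by
      intro z hz w
      simp only [Q, classOf, Prod.mk.injEq, Finset.mem_filter, Finset.mem_univ, true_and,
        and_iff_left_iff_imp]
      exact fun h => hmono w z (h ▸ hz) h
    have hXp : ∀ x ∈ X ij, p x = ij.1 := fun x hx => by simpa [classOf] using hX hx
    have hYp : ∀ x ∈ Y ij, p x = ij.2 := fun x hx => by simpa [classOf] using hY hx
    have hεs : 0 < ε * s := by positivity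
    have hXne : (X ij).Nonempty :=
      Finset.card_pos.mp (by exact_mod_cast hεs.trans_le hXc)
    have hYne : (Y ij).Nonempty :=
      Finset.card_pos.mp (by exact_mod_cast hεs.trans_le hYc)
    have hkey := increment_on_set ha (Q := Prod.map Q Q) (R := Prod.map R R)
      (S := X ij ×ˢ Y ij) (hXne.product hYne) ?_ hε (t := t ij) ?_ hijC ?_ ?_
    · calc (ε * s) ^ 2 * g ≤ #(X ij ×ˢ Y ij) * g := by
            gcongr
            rw [Finset.card_product, Nat.cast_mul, sq]
            exact mul_le_mul hXc hYc hεs.le (Nat.cast_nonneg _)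
        _ ≤ ∑ x ∈ X ij ×ˢ Y ij, inc x := hkey
        _ ≤ ∑ x with Prod.map p p x = ij, inc x := by
            refine Finset.sum_le_sum_of_subset_of_nonneg (fun x hx => ?_) fun x _ _ => hinc0 x
            obtain ⟨h1, h2⟩ := Finset.mem_product.mp hx
            simp [Prod.ext_iff, hXp _ h1, hYp _ h2]
    · intro x y h
      simp only [Prod.map, R, Prod.mk.injEq] at h
      have h1 := congrArg Prod.fst (congrFun h.1.2 ij)
      have h2 := congrArg Prod.snd (congrFun h.2.2 ij)
      simp only [Finset.mem_product] at h1 h2 ⊢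
      rw [h1, h2]
    · exact div_nonneg (div_nonneg (Nat.cast_nonneg _) (by positivity)) hd.le
    · rintro ⟨x, y⟩ hxy
      obtain ⟨h1, h2⟩ := Finset.mem_product.mp hxy
      have hx := hXp x h1
      have hy := hYp y h2
      rw [cellAvg_normAdj G (hcell x (hx ▸ hi)) (hcell y (hy ▸ hj)), hx, hy]
    · rw [avg_normAdj, htdef, ← sub_div, abs_div, abs_of_pos hd, le_div_iff₀ hd]
      exact hdev
  have hsum : #(B.filter (fun ij => t ij ≤ C)) * ((ε * s) ^ 2 * g) ≤ ∑ x, inc x := by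
    rw [← Finset.sum_fiberwise univ (Prod.map p p) inc, ← nsmul_eq_mul]
    refine (Finset.card_nsmul_le_sum _ _ _ hpair).trans ?_
    exact Finset.sum_le_sum_of_subset_of_nonneg (Finset.subset_univ _)
      fun ij _ _ => Finset.sum_nonneg fun x _ => hinc0 x
  have hdense := card_dense_pairs_le hG p hp (C := C) (B.filter fun ij => ¬ t ij ≤ C)
    fun ij hij => by
      obtain ⟨hijB, hijC⟩ := Finset.mem_filter.mp hij
      exact ⟨(hB ij hijB).1, (hB ij hijB).2.1, (not_le.mp hijC).le⟩
  have hsplit : (#(B.filter fun ij => t ij ≤ C) : ℝ) + #(B.filter fun ij => ¬ t ij ≤ C) = #B := by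
    exact_mod_cast Finset.card_filter_add_card_filter_not (s := B) fun ij => t ij ≤ C
  have hn2 : (n : ℝ) ^ 2 ≤ 4 * (k : ℝ) ^ 2 * (s : ℝ) ^ 2 := by
    calc (n : ℝ) ^ 2 ≤ (2 * (k * s)) ^ 2 := by gcongr
      _ = _ := by ring
  have hdense' : (#(B.filter fun ij => ¬ t ij ≤ C) : ℝ) ≤ ε / 2 * (k : ℝ) ^ 2 := by
    have h1 := hdense.trans hn2
    rw [hC] at h1
    have h2 : (#(B.filter fun ij => ¬ t ij ≤ 8 / ε) : ℝ) * 8 / ε ≤ 4 * (k : ℝ) ^ 2 := by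
      refine le_of_mul_le_mul_right ?_ (show (0 : ℝ) < (s : ℝ) ^ 2 by positivity)
      calc _ = (#(B.filter fun ij => ¬ t ij ≤ 8 / ε) : ℝ) * ((s : ℝ) ^ 2 * (8 / ε)) := by ring
        _ ≤ _ := h1
    rw [div_le_iff₀ hε] at h2
    rw [hC]
    linarith
  have hgood : ε / 2 * (k : ℝ) ^ 2 ≤ #(B.filter fun ij => t ij ≤ C) := by linarith
  have hfinal : ε ^ 5 / (8 * (1 + C + ε) ^ 3) * (n : ℝ) ^ 2 ≤ ∑ x, inc x := by
    calc ε ^ 5 / (8 * (1 + C + ε) ^ 3) * (n : ℝ) ^ 2 = ε ^ 3 / 8 * g * (n : ℝ) ^ 2 := by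
          rw [hg]
          field_simp
      _ ≤ ε ^ 3 / 8 * g * (4 * (k : ℝ) ^ 2 * (s : ℝ) ^ 2) := by gcongr
      _ = (ε / 2 * (k : ℝ) ^ 2) * ((ε * s) ^ 2 * g) := by ring
      _ ≤ _ := by gcongr
      _ ≤ _ := hsum
  linarith

/-- Either a given partition can be cut into a regular one, or it has a refinement of
substantially larger potential. -/
lemma regular_or_refine {ε : ℝ} (hε : 0 < ε) {K : ℕ} (hK : 0 < K) :
    ∃ M : ℕ, ∀ n, M ≤ n → ∀ G : SimpleGraph (Fin n), (∃ x y, G.Adj x y) →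
      ∀ P : Fin n → Fin K,
        (∃ (k : ℕ) (p : Fin n → Fin (k + 1)),
          K ≤ k ∧ k ≤ M ∧ ScaledEpsRegularGraphPartition G ε p) ∨
        ∃ R : Fin n → Fin ((M + 1) * K * 4 ^ ((M + 1) ^ 2)),
          potential (normAdj G) (Prod.map P P) +
              ε ^ 5 / (8 * (1 + 8 / ε + ε) ^ 3) * (n : ℝ) ^ 2 ≤
            potential (normAdj G) (Prod.map R R) := by
  classical
  set e : ℝ := min ε 1 / 2 with he
  have hepos : 0 < e := by positivity
  have heε : e < ε := by
    have := min_le_left ε 1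
    linarith
  have he2 : e ≤ 1 / 2 := by
    have := min_le_right ε 1
    linarith
  have hK' : (0 : ℝ) < K := by exact_mod_cast hK
  refine ⟨⌈2 * K / e⌉₊, fun n hn G hG P => ?_⟩
  set M := ⌈2 * K / e⌉₊
  have hnR : 2 * K / e ≤ n := (Nat.le_ceil _).trans (Nat.cast_le.mpr hn)
  have hn0 : (0 : ℝ) < n := lt_of_lt_of_le (by positivity) hnR
  rw [div_le_iff₀ hepos] at hnR
  set s := ⌊e * n / K⌋₊
  have hsle : K * (s : ℝ) ≤ e * n := by
    have := Nat.floor_le (show 0 ≤ e * n / K by positivity)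
    rw [le_div_iff₀ hK'] at this
    linarith
  have hsge : e * n / (2 * K) ≤ s := by
    have h1 := Nat.lt_floor_add_one (e * n / K)
    have h2 : 1 ≤ e * n / (2 * K) := by
      rw [le_div_iff₀ (by positivity)]
      linarith
    have h3 : e * n / K = 2 * (e * n / (2 * K)) := by field_simp
    have h4 : e * n / K < s + 1 := h1
    linarith
  have hs : 0 < s := by
    have : (0 : ℝ) < s := lt_of_lt_of_le (by positivity) hsge
    exact_mod_cast this
  have hs' : (0 : ℝ) < s := by exact_mod_cast hs
  obtain ⟨k, p, hp, hmono, hp0⟩ := exists_monochromatic_pieces hs P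
  have hp0' : ((classOf p 0).card : ℝ) ≤ e * n :=
    le_trans (by exact_mod_cast hp0) hsle
  have hcount : (n : ℝ) = (classOf p 0).card + k * s := by
    have h1 : n = ∑ i, (classOf p i).card := by
      have := Finset.card_eq_sum_card_fiberwise (s := (univ : Finset (Fin n)))
        (t := (univ : Finset (Fin (k + 1)))) (f := p)
        fun x _ => Finset.mem_coe.mpr (Finset.mem_univ _)
      simpa [classOf] using this
    rw [Fin.sum_univ_succ, Finset.sum_congr rfl fun i _ => hp i.succ (Fin.succ_ne_zero i)] at h1
    simp only [Finset.sum_const, Finset.card_univ, Fintype.card_fin, smul_eq_mul] at h1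
    exact_mod_cast h1
  have hhalf : (n : ℝ) ≤ 2 * (k * s) := by nlinarith
  have hkK : K ≤ k := by
    have h1 : (K : ℝ) * s ≤ k * s := by nlinarith
    exact_mod_cast le_of_mul_le_mul_right h1 hs'
  have hkM : k ≤ M := by
    have h1 : (k : ℝ) * s ≤ n := by
      have : (0 : ℝ) ≤ (classOf p 0).card := Nat.cast_nonneg _
      linarith
    have h2 : (k : ℝ) ≤ 2 * K / e := by
      rw [le_div_iff₀ hepos]
      rw [div_le_iff₀ (by positivity)] at hsge
      have h3 : (k : ℝ) * e * n ≤ 2 * K * n := by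
        calc (k : ℝ) * e * n = k * (e * n) := by ring
          _ ≤ k * (s * (2 * K)) := by gcongr
          _ = 2 * K * (k * s) := by ring
          _ ≤ 2 * K * n := by gcongr
      exact le_of_mul_le_mul_right h3 hn0
    exact Nat.cast_le.mp (h2.trans (Nat.le_ceil _))
  by_cases hreg : ScaledEpsRegularGraphPartition G ε p
  · exact Or.inl ⟨k, p, hkK, hkM, hreg⟩
  right
  have hbal : BalancedP p := fun i j hi hj => (hp i hi).trans (hp j hj).symm
  have hexc : ((classOf p 0).card : ℝ) < ε * n :=
    hp0'.trans_lt (mul_lt_mul_of_pos_right heε hn0)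
  simp only [ScaledEpsRegularGraphPartition, hbal, hexc, true_and, not_le] at hreg
  obtain ⟨R, hR⟩ := exists_refinement hG hε hs P p hp hmono hhalf _ (fun ij hij => by
    obtain ⟨h1, h2, h3⟩ := (Finset.mem_filter.mp hij).2
    exact ⟨(Fin.zero_le _).trans_lt h2 |>.ne', h1, h3⟩) hreg.le
  have hcard : Fintype.card ((Fin (k + 1) × Fin K) ×
      (Fin (k + 1) × Fin (k + 1) → Prop × Prop)) ≤
      Fintype.card (Fin ((M + 1) * K * 4 ^ ((M + 1) ^ 2))) := by
    simp only [Fintype.card_prod, Fintype.card_fin, Fintype.card_fun, Fintype.card_prop]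
    rw [← sq (k + 1)]
    gcongr
    norm_num
  obtain ⟨φ⟩ := Function.Embedding.nonempty_of_card_le hcard
  refine ⟨φ ∘ R, hR.trans (potential_mono (normAdj_nonneg G) fun x y h => ?_)⟩
  simpa [Prod.map] using h

lemma exists_regular_of_potential {ε δ : ℝ} (hε : 0 < ε)
    (hδ : δ = ε ^ 5 / (8 * (1 + 8 / ε + ε) ^ 3)) (t : ℕ) :
    ∀ K : ℕ, 0 < K → ∃ M : ℕ, ∀ n, M ≤ n → ∀ G : SimpleGraph (Fin n), (∃ x y, G.Adj x y) →
      ∀ P : Fin n → Fin K, (1 - t * δ) * (n : ℝ) ^ 2 < potential (normAdj G) (Prod.map P P) →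
        ∃ (k : ℕ) (p : Fin n → Fin (k + 1)),
          K ≤ k ∧ k ≤ M ∧ ScaledEpsRegularGraphPartition G ε p := by
  induction t with
  | zero =>
    refine fun K _ => ⟨0, fun n _ G _ P h => ?_⟩
    have := potential_le_card (normAdj_nonneg G) (Prod.map P P)
    simp only [Fintype.card_prod, Fintype.card_fin] at this
    push_cast at this h
    nlinarith
  | succ t ih =>
    intro K hK
    obtain ⟨M₁, hM₁⟩ := regular_or_refine hε hK
    have hle : K ≤ (M₁ + 1) * K * 4 ^ ((M₁ + 1) ^ 2) := by
      calc K = 1 * K * 1 := by simp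
        _ ≤ _ := by
          gcongr
          · omega
          · exact Nat.one_le_pow _ _ (by norm_num)
    obtain ⟨M₂, hM₂⟩ := ih _ (hK.trans_le hle)
    refine ⟨max M₁ M₂, fun n hn G hG P hP => ?_⟩
    rcases hM₁ n (le_of_max_le_left hn) G hG P with ⟨k, p, h1, h2, h3⟩ | ⟨R, hR⟩
    · exact ⟨k, p, h1, le_max_of_le_left h2, h3⟩
    · rw [← hδ] at hR
      push_cast at hP
      obtain ⟨k, p, h1, h2, h3⟩ := hM₂ n (le_of_max_le_right hn) G hG R (by linarith)
      exact ⟨k, p, hle.trans h1, le_max_of_le_right h2, h3⟩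

end Graph

/-- **Szemerédi's Regularity Lemma for sparse graphs.**  For every `ε > 0` and every
positive integer `m` there is a positive integer `M ≥ m` such that every graph `G` with at
least `M` vertices and at least one edge has an `(ε)`-regular partition
`𝒫 = V₀ ∪ V₁ ∪ ⋯ ∪ V_k` with exceptional set `V₀` and `m ≤ k ≤ M`. -/
theorem sparse_regularity_for_graphs (ε : ℝ) (hε : 0 < ε) (m : ℕ) (hm : 0 < m) :
    ∃ M : ℕ, 0 < M ∧ m ≤ M ∧
      ∀ n : ℕ, M ≤ n → ∀ G : SimpleGraph (Fin n), (∃ x y, G.Adj x y) →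
        ∃ (k : ℕ) (p : Fin n → Fin (k + 1)),
          m ≤ k ∧ k ≤ M ∧ ScaledEpsRegularGraphPartition G ε p := by
  set δ : ℝ := ε ^ 5 / (8 * (1 + 8 / ε + ε) ^ 3) with hδ
  have hδpos : 0 < δ := by positivity
  obtain ⟨t, ht⟩ := exists_nat_gt (1 / δ)
  rw [div_lt_iff₀ hδpos] at ht
  obtain ⟨M, hM⟩ := exists_regular_of_potential hε hδ t m hm
  refine ⟨max M m, lt_max_of_lt_right hm, le_max_right _ _, fun n hn G hG => ?_⟩
  have hn0 : (0 : ℝ) < n := by exact_mod_cast hm.trans_le (le_of_max_le_right hn)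
  obtain ⟨k, p, h1, h2, h3⟩ := hM n (le_of_max_le_left hn) G hG (fun _ => ⟨0, hm⟩)
    (lt_of_lt_of_le (mul_neg_of_neg_of_pos (by linarith) (by positivity))
      (potential_nonneg (normAdj_nonneg G) _))
  exact ⟨k, p, h1, le_max_of_le_left h2, h3⟩
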